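/- arXiv:0811.2346 — 3 statements merged into one kernel-verified Lean document; each statement's English description precedes it below -/
import Mathlib

section
/- For every integer n ≥ 1, the binomial coefficients satisfy C(n² + n, n) ≤ 4·n^{2n−1} and C(n² − 1 + n, n) ≤ 2·n^{2n−1}, where C(a,b) denotes the binomial coefficient a choose b. -/
/-- A quadratic bound on the ratio of a rising factorial to the corresponding power. -/
theorem ascFactorial_mul_self_le (m k : ℕ) (h : k ^ 2 ≤ m) :
    m.ascFactorial k * m ≤ m ^ k * (m + k ^ 2) := by
  induction k with
  | zero => simp
  | succ k ih =>
    have hk : k ^ 2 ≤ m := (Nat.pow_le_pow_left k.le_succ 2).trans h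
    calc m.ascFactorial (k + 1) * m = (m + k) * (m.ascFactorial k * m) := by
          rw [Nat.ascFactorial_succ, mul_assoc]
      _ ≤ (m + k) * (m ^ k * (m + k ^ 2)) := Nat.mul_le_mul_left _ (ih hk)
      _ = m ^ k * ((m + k) * (m + k ^ 2)) := by ring
      _ ≤ m ^ k * (m * (m + (k + 1) ^ 2)) := by
          refine Nat.mul_le_mul_left _ ?_
          nlinarith [Nat.mul_le_mul_left k hk]
      _ = m ^ (k + 1) * (m + (k + 1) ^ 2) := by ring

theorem choose_sq_sub_one_add_le (n : ℕ) (hn : 1 ≤ n) :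
    Nat.choose (n ^ 2 - 1 + n) n ≤ 2 * n ^ (2 * n - 1) := by
  have hpos : 0 < n ^ 2 := by positivity
  have hasc : (n ^ 2).ascFactorial n ≤ 2 * n ^ (2 * n) := by
    refine Nat.le_of_mul_le_mul_right ?_ hpos
    calc (n ^ 2).ascFactorial n * n ^ 2 ≤ (n ^ 2) ^ n * (n ^ 2 + n ^ 2) :=
          ascFactorial_mul_self_le _ _ le_rfl
      _ = 2 * n ^ (2 * n) * n ^ 2 := by rw [← pow_mul]; ring
  rw [Nat.ascFactorial_eq_factorial_mul_choose', Nat.sub_add_comm hpos] at hasc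
  refine Nat.le_of_mul_le_mul_left ?_ hn
  calc n * (n ^ 2 - 1 + n).choose n ≤ n.factorial * (n ^ 2 - 1 + n).choose n := by
        gcongr
        exact n.self_le_factorial
    _ ≤ 2 * n ^ (2 * n) := hasc
    _ = n * (2 * n ^ (2 * n - 1)) := by
        rw [mul_left_comm, mul_pow_sub_one (by omega)]

theorem choose_sq_add_le_two_mul (n : ℕ) (hn : 1 ≤ n) :
    Nat.choose (n ^ 2 + n) n ≤ 2 * Nat.choose (n ^ 2 - 1 + n) n := by
  obtain ⟨k, rfl⟩ := Nat.exists_eq_add_of_le' hn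
  have hN : (k + 1) ^ 2 - 1 + (k + 1) = (k + 1) ^ 2 + k := by
    have : 0 < (k + 1) ^ 2 := by positivity
    omega
  rw [hN, ← add_assoc, Nat.choose_succ_succ, two_mul]
  gcongr ?_ + _
  have h := Nat.choose_succ_right_eq ((k + 1) ^ 2 + k) k
  rw [Nat.add_sub_cancel] at h
  refine Nat.le_of_mul_le_mul_right ?_ hn
  rw [h]
  gcongr
  nlinarith

/-- Second half of Lemma 4.6 of the paper: `C(n²+n, n) ≤ 4 n^(2n-1)` and
`C(n²-1+n, n) ≤ 2 n^(2n-1)` for every `n ≥ 1`. -/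
theorem binomial_bounds (n : ℕ) (hn : 1 ≤ n) :
    Nat.choose (n ^ 2 + n) n ≤ 4 * n ^ (2 * n - 1) ∧
    Nat.choose (n ^ 2 - 1 + n) n ≤ 2 * n ^ (2 * n - 1) := by
  have h₁ := choose_sq_sub_one_add_le n hn
  have h₂ := choose_sq_add_le_two_mul n hn
  exact ⟨by omega, h₁⟩
end

section
/- Work in the polynomial ring ℂ[x_{i,α} : 1 ≤ i ≤ 3, 1 ≤ α ≤ 3] in nine variables, where x_{i,α} represents the α-th derivative f_i^{(α)}. Define W1 := x_{1,1}; W3 := x_{1,1}·x_{2,2} − x_{2,1}·x_{1,2}; W5 := (x_{1,1}·x_{2,3} − x_{2,1}·x_{1,3})·x_{1,1} − 3·(x_{1,1}·x_{2,2} − x_{2,1}·x_{1,2})·x_{1,2}; and W6 := det of the 3×3 matrix whose (α,i)-entry is x_{i,α} (the three-dimensional Wronskian). Then the four polynomials W1, W3, W5, W6 are algebraically independent over ℂ. -/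
namespace BiInvariants3

/-- The jet variable `x_{i,α}` representing the `α`-th derivative `f_i^(α)`
(zero-based indices: `x i α` stands for `f_{i+1}^{(α+1)}`). -/
noncomputable def x (i α : Fin 3) : MvPolynomial (Fin 3 × Fin 3) ℂ :=
  MvPolynomial.X (i, α)

/-- `f₁'`. -/
noncomputable def W1 : MvPolynomial (Fin 3 × Fin 3) ℂ := x 0 0

/-- `Λ³ = f₁' f₂'' - f₂' f₁''`. -/
noncomputable def W3 : MvPolynomial (Fin 3 × Fin 3) ℂ := x 0 0 * x 1 1 - x 1 0 * x 0 1

/-- `Λ⁵ = (f₁' f₂''' - f₂' f₁''') f₁' - 3 (f₁' f₂'' - f₂' f₁'') f₁''`. -/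
noncomputable def W5 : MvPolynomial (Fin 3 × Fin 3) ℂ :=
  (x 0 0 * x 1 2 - x 1 0 * x 0 2) * x 0 0 - 3 * (x 0 0 * x 1 1 - x 1 0 * x 0 1) * x 0 1

/-- `D⁶`: the three-dimensional Wronskian, the determinant of the matrix whose
`(α,i)`-entry is `x_{i,α}`. -/
noncomputable def W6 : MvPolynomial (Fin 3 × Fin 3) ℂ :=
  Matrix.det (Matrix.of fun α i : Fin 3 => x i α)

/-- Every point of `ℂ⁴` with nonzero first two coordinates is the value of `(W1, W3, W5, W6)` at
some jet. -/
lemma exists_eval_biInvariants_eq {w : Fin 4 → ℂ} (h₀ : w 0 ≠ 0) (h₁ : w 1 ≠ 0) :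
    ∃ p : Fin 3 × Fin 3 → ℂ, ∀ k, MvPolynomial.eval p (![W1, W3, W5, W6] k) = w k := by
  refine ⟨fun q => !![w 0, 0, 0; 0, w 1 / w 0, w 2 / w 0 ^ 2; 0, 0, w 3 / w 1] q.1 q.2, ?_⟩
  intro k
  fin_cases k <;> simp [W1, W3, W5, W6, x, Matrix.det_fin_three] <;> field_simp

/-- The four basic bi-invariant 3-jet polynomials in dimension 3 are algebraically
independent over `ℂ`. -/
theorem algebraicIndependent_biInvariants :
    AlgebraicIndependent ℂ ![W1, W3, W5, W6] := by
  rw [algebraicIndependent_iff]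
  intro P hP
  have hmul : P * (MvPolynomial.X 0 * MvPolynomial.X 1) = 0 := by
    refine MvPolynomial.funext fun w => ?_
    by_cases h₀ : w 0 = 0
    · simp [h₀]
    by_cases h₁ : w 1 = 0
    · simp [h₁]
    obtain ⟨p, hp⟩ := exists_eval_biInvariants_eq h₀ h₁
    have hPw : MvPolynomial.eval w P = 0 := by
      have h := congrArg (MvPolynomial.aeval p) hP
      rw [← AlgHom.comp_apply, MvPolynomial.comp_aeval, map_zero] at h
      simpa only [MvPolynomial.aeval_eq_eval, hp] using h
    simp [hPw]
  simpa [MvPolynomial.X_ne_zero] using hmul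

end BiInvariants3
end

section
/- Work in the polynomial ring ℂ[x_{i,α} : 1 ≤ i ≤ 2, 1 ≤ α ≤ 4], where x_{i,α} represents the α-th derivative f_i^{(α)}; write Δ^{α,β} := x_{1,α}·x_{2,β} − x_{2,α}·x_{1,β}. Define Λ³ := Δ^{1,2}; Λ⁵ := Δ^{1,3}·x_{1,1} − 3·Δ^{1,2}·x_{1,2}; and Λ⁷ := Δ^{1,4}·x_{1,1}² + Δ^{2,3}·x_{1,1}² − 10·Δ^{1,3}·x_{1,1}·x_{1,2} + 15·Δ^{1,2}·x_{1,2}². Then x_{1,1}² divides the polynomial 3·Λ³·Λ⁷ − 5·Λ⁵·Λ⁵; that is, M⁸ := (−5Λ⁵Λ⁵ + 3Λ³Λ⁷)/(x_{1,1})² is a true polynomial. -/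
namespace BiInvariantM8

/-- The jet variable `x_{i,α}` representing the `α`-th derivative `f_i^(α)`
(zero-based indices: `x i α` stands for `f_{i+1}^{(α+1)}`). -/
noncomputable def x (i : Fin 2) (α : Fin 4) : MvPolynomial (Fin 2 × Fin 4) ℂ :=
  MvPolynomial.X (i, α)

/-- `Δ^{α,β} = f₁^{(α)} f₂^{(β)} - f₂^{(α)} f₁^{(β)}`. -/
noncomputable def Δ (α β : Fin 4) : MvPolynomial (Fin 2 × Fin 4) ℂ :=
  x 0 α * x 1 β - x 1 α * x 0 β

/-- `Λ³ = Δ^{1,2}`. -/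
noncomputable def Λ3 : MvPolynomial (Fin 2 × Fin 4) ℂ := Δ 0 1

/-- `Λ⁵ = Δ^{1,3} f₁' - 3 Δ^{1,2} f₁''`. -/
noncomputable def Λ5 : MvPolynomial (Fin 2 × Fin 4) ℂ :=
  Δ 0 2 * x 0 0 - 3 * Δ 0 1 * x 0 1

/-- `Λ⁷ = Δ^{1,4} f₁'² + Δ^{2,3} f₁'² - 10 Δ^{1,3} f₁' f₁'' + 15 Δ^{1,2} f₁''²`. -/
noncomputable def Λ7 : MvPolynomial (Fin 2 × Fin 4) ℂ :=
  Δ 0 3 * x 0 0 ^ 2 + Δ 1 2 * x 0 0 ^ 2 - 10 * Δ 0 2 * x 0 0 * x 0 1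
    + 15 * Δ 0 1 * x 0 1 ^ 2

/-- `M⁸ = (-5 Λ⁵ Λ⁵ + 3 Λ³ Λ⁷) / f₁'²` is a true polynomial: `f₁'²` divides
`3 Λ³ Λ⁷ - 5 Λ⁵ Λ⁵`. -/
theorem x11_sq_dvd : (x 0 0) ^ 2 ∣ 3 * Λ3 * Λ7 - 5 * Λ5 * Λ5 := by
  refine ⟨3 * Δ 0 1 * (Δ 0 3 + Δ 1 2) - 5 * Δ 0 2 ^ 2, ?_⟩
  rw [Λ3, Λ5, Λ7]
  ring

end BiInvariantM8
end
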